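/- Let U ⊆ ℝ be open, let (S,𝒜,μ) be a complete σ-finite measure space, and let f : U × S → ℝ be jointly measurable such that: (1) for every x ∈ U, the function f(x,·) is μ-integrable; (2) for μ-almost every s ∈ S, the function f(·,s) is absolutely continuous on U; (3) the partial derivative ∂f/∂x is locally integrable jointly in (x,s), i.e., for every compact interval [a,b] ⊆ U, ∫_S ∫_a^b |∂f/∂x(x,s)| dx dμ(s) < ∞. Then the function g : x ↦ ∫_S f(x,s) dμ(s) is absolutely continuous on every compact interval of U, and for Lebesgue-almost every x ∈ U, g is differentiable at x with g'(x) = ∫_S ∂f/∂x(x,s) dμ(s). -/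

import Mathlib

open MeasureTheory Filter Topology Set

noncomputable section

/-- A real-valued function is absolutely continuous on a set `s` of reals. -/
def AbsolutelyContinuousOnSet {E : Type*} [NormedAddCommGroup E] (f : ℝ → E) (s : Set ℝ) : Prop :=
  ∀ ε > (0:ℝ), ∃ δ > (0:ℝ), ∀ n : ℕ, ∀ a b : Fin n → ℝ,
    (∀ i, a i ≤ b i ∧ Set.Icc (a i) (b i) ⊆ s) →
    (Pairwise fun i j => Disjoint (Set.Ioo (a i) (b i)) (Set.Ioo (a j) (b j))) →
    (∑ i, (b i - a i)) < δ → (∑ i, ‖f (b i) - f (a i)‖) < ε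

/-- On a compact interval, `AbsolutelyContinuousOnSet` agrees with
`AbsolutelyContinuousOnInterval`. -/
theorem absolutelyContinuousOnSet_Icc_iff {E : Type*} [NormedAddCommGroup E] {f : ℝ → E}
    {a b : ℝ} (hab : a ≤ b) :
    AbsolutelyContinuousOnSet f (Icc a b) ↔ AbsolutelyContinuousOnInterval f a b := by
  rw [absolutelyContinuousOnInterval_iff]
  refine forall₂_congr fun ε _ => exists_congr fun δ => and_congr_right fun _ => ⟨?_, ?_⟩
  · rintro h ⟨n, I⟩ ⟨hI, hdisj⟩ hlen
    simp only [uIcc_of_le hab, Finset.mem_range] at hI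
    have := h n (fun i => min (I i).1 (I i).2) (fun i => max (I i).1 (I i).2)
      (fun i => ⟨min_le_max, Icc_subset_Icc (le_min (hI i i.2).1.1 (hI i i.2).2.1)
        (max_le (hI i i.2).1.2 (hI i i.2).2.2)⟩)
      (fun i j hij => (hdisj (by simp) (by simp) (Fin.val_ne_of_ne hij)).mono
        Ioo_subset_Ioc_self Ioo_subset_Ioc_self)
      (by
        refine lt_of_eq_of_lt ?_ hlen
        simp only [max_sub_min_eq_abs', Finset.sum_range, Real.dist_eq])
    refine lt_of_eq_of_lt ?_ this
    simp only [Finset.sum_range]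
    refine Finset.sum_congr rfl fun i _ => ?_
    rcases le_total (I i).1 (I i).2 with h' | h'
    · rw [min_eq_left h', max_eq_right h', dist_eq_norm']
    · rw [min_eq_right h', max_eq_left h', dist_eq_norm]
  · intro h n x y hxy hdisj hlen
    let I : ℕ → ℝ × ℝ := fun i => if hi : i < n then (x ⟨i, hi⟩, y ⟨i, hi⟩) else (a, a)
    have hI : ∀ i : Fin n, I i = (x i, y i) := fun i => by simp [I]
    have := h (n, I) ⟨fun i hi => ?_, fun i hi j hj hij => ?_⟩ ?_
    · simpa only [Finset.sum_range, hI, dist_eq_norm'] using this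
    · lift i to Fin n using Finset.mem_range.1 hi
      simp only [hI, uIcc_of_le hab]
      exact ⟨(hxy i).2 (left_mem_Icc.2 (hxy i).1), (hxy i).2 (right_mem_Icc.2 (hxy i).1)⟩
    · lift i to Fin n using by simpa using hi
      lift j to Fin n using by simpa using hj
      have := hdisj (Fin.val_ne_iff.1 hij)
      simp only [Function.onFun, hI, uIoc_of_le (hxy i).1, uIoc_of_le (hxy j).1]
      rwa [Ioc_disjoint_Ioc, ← Ioo_disjoint_Ioo]
    · refine lt_of_eq_of_lt ?_ hlen
      simp only [Finset.sum_range, hI, Real.dist_eq]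
      exact Finset.sum_congr rfl fun i _ => by
        rw [abs_sub_comm, abs_of_nonneg (sub_nonneg.2 (hxy i).1)]

theorem AbsolutelyContinuousOnSet.congr_sub {E : Type*} [NormedAddCommGroup E] {f g : ℝ → E}
    {s : Set ℝ} (hf : AbsolutelyContinuousOnSet f s)
    (h : ∀ x ∈ s, ∀ y ∈ s, g y - g x = f y - f x) : AbsolutelyContinuousOnSet g s := by
  intro ε hε
  obtain ⟨δ, hδ, H⟩ := hf ε hε
  refine ⟨δ, hδ, fun n a b hab hdisj hlen => ?_⟩
  refine lt_of_eq_of_lt (Finset.sum_congr rfl fun i _ => ?_) (H n a b hab hdisj hlen)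
  rw [h _ ((hab i).2 (left_mem_Icc.2 (hab i).1)) _ ((hab i).2 (right_mem_Icc.2 (hab i).1))]

theorem absolutelyContinuousOnSet_empty {E : Type*} [NormedAddCommGroup E] (f : ℝ → E) :
    AbsolutelyContinuousOnSet f ∅ := by
  refine fun ε hε => ⟨1, one_pos, fun n a b hab _ _ => ?_⟩
  rw [Finset.sum_eq_zero fun i _ => ?_]
  · exact hε
  · exact ((hab i).2 (left_mem_Icc.2 (hab i).1)).elim

/-- A property which holds almost everywhere on each compact interval contained in an open set
holds almost everywhere on this set. -/
theorem IsOpen.ae_of_forall_Icc {U : Set ℝ} (hU : IsOpen U) {P : ℝ → Prop}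
    (h : ∀ a b, a < b → Icc a b ⊆ U → ∀ᵐ x, x ∈ Ioo a b → P x) : ∀ᵐ x, x ∈ U → P x := by
  rw [ae_iff]
  refine measure_null_of_locally_null _ fun x hx => ?_
  have hxU : x ∈ U := by by_contra h'; exact hx fun h => absurd h h'
  obtain ⟨r, hr, hrU⟩ := Metric.nhds_basis_closedBall.mem_iff.1 (hU.mem_nhds hxU)
  rw [Real.closedBall_eq_Icc] at hrU
  refine ⟨_, inter_mem_nhdsWithin _ (Ioo_mem_nhds (a := x - r) (b := x + r) (by linarith)
    (by linarith)), measure_mono_null ?_ (ae_iff.1 (h _ _ (by linarith) hrU))⟩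
  exact fun y hy h' => hy.1 fun _ => h' hy.2

/-- The filter of nonzero rational numbers tending to `0`. -/
def ratNhdsNE : Filter ℚ := comap ((↑) : ℚ → ℝ) (𝓝[≠] 0)

instance : ratNhdsNE.NeBot := by
  unfold ratNhdsNE
  rw [comap_neBot_iff]
  intro t ht
  obtain ⟨u, hu, hu0, hut⟩ := mem_nhdsWithin.1 ht
  obtain ⟨ε, hε, hεu⟩ := Metric.isOpen_iff.1 hu 0 hu0
  obtain ⟨q, hq0, hq⟩ := exists_rat_btwn hε
  refine ⟨q, hut ⟨hεu ?_, ?_⟩⟩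
  · rw [Metric.mem_ball, dist_zero_right, Real.norm_eq_abs, abs_of_pos hq0]; exact hq
  · exact hq0.ne'

instance : ratNhdsNE.IsCountablyGenerated := by
  unfold ratNhdsNE; infer_instance

/-- For a function which is continuous near `x`, the derivative at `x` may be computed as the
limit of the difference quotients with rational increments. -/
theorem hasDerivAt_iff_tendsto_ratNhdsNE {u : ℝ → ℝ} {x c : ℝ}
    (hu : ∀ᶠ y in 𝓝 x, ContinuousAt u y) :
    HasDerivAt u c x ↔
      Tendsto (fun q : ℚ => (q : ℝ)⁻¹ * (u (x + q) - u x)) ratNhdsNE (𝓝 c) := by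
  rw [hasDerivAt_iff_tendsto_slope_zero]
  refine ⟨fun h => h.comp tendsto_comap, fun h => ?_⟩
  refine (Metric.nhds_basis_closedBall.tendsto_right_iff).2 fun ε hε => ?_
  have h1 := h (Metric.closedBall_mem_nhds c hε)
  obtain ⟨t, ht, hts⟩ := h1
  obtain ⟨v, hv, hv0, hvt⟩ := mem_nhdsWithin.1 ht
  have hu' : ∀ᶠ y in 𝓝 (0 : ℝ), ContinuousAt u (x + y) := by
    have : ContinuousAt (fun y : ℝ => x + y) 0 := by fun_prop
    exact this.eventually (by simpa using hu)
  filter_upwards [mem_nhdsWithin_of_mem_nhds hu', mem_nhdsWithin_of_mem_nhds (hv.mem_nhds hv0),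
    self_mem_nhdsWithin] with y hy hyv hy0
  have hcont : ContinuousAt (fun z : ℝ => z⁻¹ • (u (x + z) - u x)) y :=
    (continuousAt_id.inv₀ hy0).smul
      ((ContinuousAt.comp (f := fun z => x + z) hy (by fun_prop)).sub continuousAt_const)
  by_contra hmem
  have hev : _ ∈ 𝓝 y := hcont.preimage_mem_nhds
    (Metric.isClosed_closedBall.isOpen_compl.mem_nhds hmem)
  have hev2 := inter_mem (inter_mem hev (hv.mem_nhds hyv)) (isOpen_ne.mem_nhds hy0)
  obtain ⟨w, hww, hwo, hyw⟩ := mem_nhds_iff.1 hev2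
  obtain ⟨q, hq⟩ := Rat.denseRange_cast.exists_mem_open hwo ⟨y, hyw⟩
  have hq' := hww hq
  exact hq'.1.1 (hts (show (q : ℝ) ∈ t from hvt ⟨hq'.1.2, hq'.2⟩))

/-- For a jointly measurable `f`, the partial derivative in the first variable is measurable as
long as one only looks at points near which `f` is continuous in this variable. -/
theorem exists_measurable_deriv {S : Type*} [MeasurableSpace S] {f : ℝ → S → ℝ}
    (hf : Measurable (Function.uncurry f)) :
    ∃ (E : Set (ℝ × S)) (D : ℝ × S → ℝ), MeasurableSet E ∧ StronglyMeasurable D ∧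
      ∀ x s, (∀ᶠ y in 𝓝 x, ContinuousAt (fun y => f y s) y) →
        ((x, s) ∈ E ↔ DifferentiableAt ℝ (fun y => f y s) x) ∧
        ((x, s) ∈ E → D (x, s) = deriv (fun y => f y s) x) := by
  let φ : ℚ → ℝ × S → ℝ := fun q p => (q : ℝ)⁻¹ * (f (p.1 + q) p.2 - f p.1 p.2)
  have hφ : ∀ q, Measurable (φ q) := fun q => by
    refine ((hf.comp (f := fun p : ℝ × S => (p.1 + q, p.2)) (by fun_prop)).sub hf).const_mul _
  have hE : MeasurableSet {p | ∃ c, Tendsto (φ · p) ratNhdsNE (𝓝 c)} :=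
    measurableSet_exists_tendsto hφ
  refine ⟨_, fun p => limUnder ratNhdsNE (φ · p), hE,
    StronglyMeasurable.limUnder fun q => (hφ q).stronglyMeasurable, fun x s hs => ⟨⟨?_, ?_⟩, ?_⟩⟩
  · rintro ⟨c, hc⟩
    exact ((hasDerivAt_iff_tendsto_ratNhdsNE hs).2 hc).differentiableAt
  · exact fun h => ⟨_, (hasDerivAt_iff_tendsto_ratNhdsNE hs).1 h.hasDerivAt⟩
  · rintro ⟨c, hc⟩
    rw [((hasDerivAt_iff_tendsto_ratNhdsNE hs).2 hc).deriv]
    exact Tendsto.limUnder_eq hc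

/-- **Differentiation of absolutely continuous integrals.**  Let `U ⊆ ℝ` be open, `μ` a complete
σ-finite measure on `S`, and `f : ℝ × S → ℝ` jointly measurable such that (1) `f (x, ·)` is
integrable for every `x ∈ U`; (2) for `μ`-a.e. `s`, `f (·, s)` is absolutely continuous on `U`;
(3) the partial derivative `∂f/∂x` is locally integrable jointly in `(x, s)`.  Then
`g : x ↦ ∫ f (x, s) dμ(s)` is absolutely continuous on every compact interval of `U` and, for
Lebesgue-a.e. `x ∈ U`, `g` is differentiable at `x` with `g'(x) = ∫ ∂f/∂x (x, s) dμ(s)`. -/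
theorem differentiation_of_absolutely_continuous_integrals
    {S : Type*} [MeasurableSpace S] (μ : Measure S) [SigmaFinite μ] [μ.IsComplete]
    (U : Set ℝ) (hU : IsOpen U)
    (f : ℝ → S → ℝ) (hf : Measurable (Function.uncurry f))
    (hint : ∀ x ∈ U, Integrable (fun s => f x s) μ)
    (hAC : ∀ᵐ s ∂μ, ∀ a b : ℝ, Set.Icc a b ⊆ U →
      AbsolutelyContinuousOnSet (fun x => f x s) (Set.Icc a b))
    (hloc : ∀ a b : ℝ, Set.Icc a b ⊆ U →
      ∫⁻ s, ∫⁻ x in Set.Icc a b, (‖deriv (fun y => f y s) x‖₊ : ENNReal) ∂volume ∂μ < ⊤) :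
    (∀ a b : ℝ, Set.Icc a b ⊆ U →
      AbsolutelyContinuousOnSet (fun x => ∫ s, f x s ∂μ) (Set.Icc a b)) ∧
    (∀ᵐ x ∂(volume.restrict U),
      HasDerivAt (fun y => ∫ s, f y s ∂μ) (∫ s, deriv (fun y => f y s) x ∂μ) x) := by
  obtain ⟨E, D, hE, hD, hED⟩ := exists_measurable_deriv hf
  have hAC' : ∀ᵐ s ∂μ, ∀ a b : ℝ, a ≤ b → Icc a b ⊆ U →
      AbsolutelyContinuousOnInterval (fun x => f x s) a b := by
    filter_upwards [hAC] with s hs a b hab habU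
    exact (absolutelyContinuousOnSet_Icc_iff hab).1 (hs a b habU)
  have hcont : ∀ᵐ s ∂μ, ∀ x ∈ U, ∀ᶠ y in 𝓝 x, ContinuousAt (fun y => f y s) y := by
    filter_upwards [hAC'] with s hs x hx
    obtain ⟨r, hr, hrU⟩ := Metric.nhds_basis_closedBall.mem_iff.1 (hU.mem_nhds hx)
    rw [Real.closedBall_eq_Icc] at hrU
    have hc := (hs _ _ (by linarith) hrU).continuousOn
    rw [uIcc_of_le (by linarith)] at hc
    filter_upwards [Ioo_mem_nhds (a := x - r) (b := x + r) (by linarith) (by linarith)] with y hy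
    exact hc.continuousAt (Icc_mem_nhds hy.1 hy.2)
  have hE₁ : ∀ᵐ s ∂μ, ∀ᵐ x : ℝ, x ∈ U → (x, s) ∈ E := by
    filter_upwards [hAC', hcont] with s hs hc
    refine hU.ae_of_forall_Icc fun a b hab habU => ?_
    filter_upwards [(hs a b hab.le habU).ae_differentiableAt] with x hx hxab
    have hxab' := Ioo_subset_Icc_self hxab
    exact (hED x s (hc x (habU hxab'))).1.2 (hx (by rwa [uIcc_of_le hab.le]))
  have hE₂ : ∀ᵐ x : ℝ, ∀ᵐ s ∂μ, x ∈ U → (x, s) ∈ E :=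
    (Measure.ae_ae_comm ((hU.measurableSet.preimage measurable_fst).imp hE)).2 hE₁
  have hD₁ : ∀ᵐ s ∂μ, ∀ᵐ x : ℝ, x ∈ U → D (x, s) = deriv (fun y => f y s) x := by
    filter_upwards [hE₁, hcont] with s hs hc
    filter_upwards [hs] with x hx hxU using (hED x s (hc x hxU)).2 (hx hxU)
  have hD₂ : ∀ᵐ x : ℝ, x ∈ U → ∀ᵐ s ∂μ, D (x, s) = deriv (fun y => f y s) x := by
    filter_upwards [hE₂] with x hx hxU
    filter_upwards [hx, hcont] with s hs hc using (hED x s (hc x hxU)).2 (hs hxU)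
  have hDint : ∀ a b : ℝ, Icc a b ⊆ U →
      Integrable D ((volume.restrict (Icc a b)).prod μ) := by
    intro a b hab
    refine ⟨hD.aestronglyMeasurable, ?_⟩
    rw [HasFiniteIntegral, lintegral_prod_symm' _ hD.enorm]
    refine lt_of_eq_of_lt (lintegral_congr_ae ?_) (hloc a b hab)
    filter_upwards [hD₁] with s hs
    refine setLIntegral_congr_fun_ae measurableSet_Icc ?_
    filter_upwards [hs] with x hx hxab
    rw [hx (hab hxab)]
    rfl
  let G : ℝ → ℝ := fun x => ∫ s, D (x, s) ∂μ
  have hG : ∀ a b : ℝ, a ≤ b → Icc a b ⊆ U → IntervalIntegrable G volume a b := by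
    intro a b hab habU
    rw [intervalIntegrable_iff_integrableOn_Icc_of_le hab]
    exact (hDint a b habU).integral_prod_left
  have hFTC : ∀ a b : ℝ, Icc a b ⊆ U → ∀ x ∈ Icc a b,
      ∫ s, f x s ∂μ = ∫ s, f a s ∂μ + ∫ t in a..x, G t := by
    intro a b hab x hx
    have hax : Icc a x ⊆ U := (Icc_subset_Icc_right hx.2).trans hab
    rw [← sub_eq_iff_eq_add', ← integral_sub (hint x (hab hx))
      (hint a (hab ⟨le_rfl, hx.1.trans hx.2⟩)), intervalIntegral.integral_of_le hx.1,
      ← integral_Icc_eq_integral_Ioc,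
      integral_integral_swap (f := fun t s => D (t, s)) (hDint a x hax)]
    refine integral_congr_ae ?_
    filter_upwards [hAC', hD₁] with s hs hDs
    rw [← (hs a x hx.1 hax).integral_deriv_eq_sub, intervalIntegral.integral_of_le hx.1,
      ← integral_Icc_eq_integral_Ioc]
    refine setIntegral_congr_ae measurableSet_Icc ?_
    filter_upwards [hDs] with t ht htax using (ht (hax htax)).symm
  refine ⟨fun a b habU => ?_, ?_⟩
  · rcases le_or_gt a b with hab | hab
    · have h := (hG a b hab habU).absolutelyContinuousOnInterval_intervalIntegral left_mem_uIcc
      rw [← absolutelyContinuousOnSet_Icc_iff hab] at h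
      refine h.congr_sub fun x hx y hy => ?_
      simp only [hFTC a b habU x hx, hFTC a b habU y hy, add_sub_add_left_eq_sub]
    · rw [Icc_eq_empty hab.not_ge]
      exact absolutelyContinuousOnSet_empty _
  · rw [ae_restrict_iff' hU.measurableSet]
    refine hU.ae_of_forall_Icc fun a b hab habU => ?_
    filter_upwards [(hG a b hab.le habU).ae_hasDerivAt_integral, hD₂] with x hx hDx hxab
    have hxab' := Ioo_subset_Icc_self hxab
    rw [← integral_congr_ae (hDx (habU hxab'))]
    refine ((hx (by rwa [uIcc_of_le hab.le]) a left_mem_uIcc).const_add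
      (∫ s, f a s ∂μ)).congr_of_eventuallyEq ?_
    filter_upwards [Icc_mem_nhds hxab.1 hxab.2] with y hy using hFTC a b habU y hy

end
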